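/- For every real number b ≥ 1, the integral I(b) satisfies I(b) ≥ √2. -/

import Mathlib

open Real MeasureTheory

/-- I(b) = ∫_0^π ((2b² − (b²−1)²·sin²θ·cos²θ)·sinθ) /
      (√(1+b²+(1−b²)·cos 2θ)·(b²·cos²θ + sin²θ)^{5/2}) dθ. -/
noncomputable def ellI (b : ℝ) : ℝ :=
  ∫ θ in (0:ℝ)..Real.pi,
    ((2 * b ^ 2 - (b ^ 2 - 1) ^ 2 * Real.sin θ ^ 2 * Real.cos θ ^ 2) * Real.sin θ) /
      (Real.sqrt (1 + b ^ 2 + (1 - b ^ 2) * Real.cos (2 * θ)) *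
        (b ^ 2 * Real.cos θ ^ 2 + Real.sin θ ^ 2) ^ ((5:ℝ) / 2))

lemma ell_aux_pos (b : ℝ) (hb : 1 ≤ b) (θ : ℝ) :
    1 ≤ b ^ 2 * Real.cos θ ^ 2 + Real.sin θ ^ 2 := by
  nlinarith [Real.sin_sq_add_cos_sq θ, sq_nonneg (Real.cos θ),
    mul_nonneg (by nlinarith : 0 ≤ b ^ 2 - 1) (sq_nonneg (Real.cos θ))]

lemma ell_aux_pos' (b : ℝ) (hb : 1 ≤ b) (θ : ℝ) :
    1 ≤ b ^ 2 * Real.sin θ ^ 2 + Real.cos θ ^ 2 := by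
  nlinarith [Real.sin_sq_add_cos_sq θ, sq_nonneg (Real.sin θ),
    mul_nonneg (by nlinarith : 0 ≤ b ^ 2 - 1) (sq_nonneg (Real.sin θ))]

lemma ell_aux_K (b θ : ℝ) : 1 + b ^ 2 + (1 - b ^ 2) * Real.cos (2 * θ) =
    2 * (b ^ 2 * Real.sin θ ^ 2 + Real.cos θ ^ 2) := by
  rw [Real.cos_two_mul, Real.sin_sq]; ring

lemma ell_aux_rpow (x : ℝ) (hx : 0 ≤ x) : x ^ ((5:ℝ) / 2) = Real.sqrt x ^ 5 := by
  rw [Real.sqrt_eq_rpow, ← Real.rpow_natCast, ← Real.rpow_mul hx]; norm_num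

lemma ell_aux_deriv (b : ℝ) (hb : 1 ≤ b) (θ : ℝ) :
    HasDerivAt (fun θ => -(b * Real.cos θ) *
      (1 / Real.sqrt (b ^ 2 * Real.cos θ ^ 2 + Real.sin θ ^ 2) +
        1 / Real.sqrt (b ^ 2 * Real.cos θ ^ 2 + Real.sin θ ^ 2) ^ 3))
      (b * (3 - (b ^ 2 * Real.cos θ ^ 2 + Real.sin θ ^ 2)) * Real.sin θ /
        Real.sqrt (b ^ 2 * Real.cos θ ^ 2 + Real.sin θ ^ 2) ^ 5) θ := by
  have hP := ell_aux_pos b hb θ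
  have hP0 : b ^ 2 * Real.cos θ ^ 2 + Real.sin θ ^ 2 ≠ 0 := by positivity
  have hr : 0 < Real.sqrt (b ^ 2 * Real.cos θ ^ 2 + Real.sin θ ^ 2) := Real.sqrt_pos.2 (by linarith)
  have hr2 := Real.sq_sqrt (by linarith : 0 ≤ b ^ 2 * Real.cos θ ^ 2 + Real.sin θ ^ 2)
  have h1 := ((((Real.hasDerivAt_cos θ).pow 2).const_mul (b ^ 2)).add
    ((Real.hasDerivAt_sin θ).pow 2)).sqrt hP0
  have h2 := (((Real.hasDerivAt_cos θ).const_mul b).neg).mul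
    (((hasDerivAt_const θ (1:ℝ)).div h1 hr.ne').add
      ((hasDerivAt_const θ (1:ℝ)).div (h1.pow 3) (pow_ne_zero 3 hr.ne')))
  refine h2.congr_deriv ?_
  simp only [Pi.add_apply, Pi.pow_apply, Pi.neg_apply, Pi.div_apply]
  have hsc := Real.sin_sq_add_cos_sq θ
  generalize Real.sqrt (b ^ 2 * Real.cos θ ^ 2 + Real.sin θ ^ 2) = r at *
  generalize Real.sin θ = s at *
  generalize Real.cos θ = c at *
  have hs : s ^ 2 = 1 - c ^ 2 := by linarith
  have hk : (b ^ 2 - 1) * c ^ 2 = r ^ 2 - 1 := by linarith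
  rw [← hr2]
  field_simp
  norm_num
  linear_combination (-2 * s * (r ^ 4 + 3 * r ^ 2)) * hk

/-- For every b ≥ 1, the integral I(b) satisfies I(b) ≥ √2. -/
theorem ellI_ge_sqrt_two (b : ℝ) (hb : 1 ≤ b) : ellI b ≥ Real.sqrt 2 := by
  have hb0 : 0 < b := by linarith
  have h2 : 0 < Real.sqrt 2 := by positivity
  have h22 : Real.sqrt 2 ^ 2 = 2 := Real.sq_sqrt (by norm_num)
  have hcont : Continuous (fun θ : ℝ =>
      b * (3 - (b ^ 2 * Real.cos θ ^ 2 + Real.sin θ ^ 2)) * Real.sin θ /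
        Real.sqrt (b ^ 2 * Real.cos θ ^ 2 + Real.sin θ ^ 2) ^ 5) := by
    refine Continuous.div (by fun_prop) (by fun_prop) (fun θ => ?_)
    have := ell_aux_pos b hb θ
    have := Real.sqrt_pos.2 (by linarith : 0 < b ^ 2 * Real.cos θ ^ 2 + Real.sin θ ^ 2)
    positivity
  have hinteg := intervalIntegral.integral_eq_sub_of_hasDerivAt
    (fun θ _ => ell_aux_deriv b hb θ) (hcont.intervalIntegrable 0 Real.pi)
  have hsb : Real.sqrt (b ^ 2) = b := Real.sqrt_sq hb0.le
  simp only [Real.cos_pi, Real.sin_pi, Real.cos_zero, Real.sin_zero] at hinteg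
  norm_num [hsb] at hinteg
  have hmono : ∫ θ in (0:ℝ)..Real.pi, (b * (3 - (b ^ 2 * Real.cos θ ^ 2 + Real.sin θ ^ 2)) *
      Real.sin θ / Real.sqrt (b ^ 2 * Real.cos θ ^ 2 + Real.sin θ ^ 2) ^ 5) / Real.sqrt 2 ≤
      ellI b := by
    unfold ellI
    refine intervalIntegral.integral_mono_on Real.pi_pos.le
      ((hcont.div_const _).intervalIntegrable _ _) ?_ ?_
    · apply Continuous.intervalIntegrable
      refine Continuous.div (by fun_prop) (Continuous.mul (by fun_prop) ?_) (fun θ => ?_)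
      · exact Continuous.rpow_const (by fun_prop) (fun _ => Or.inr (by norm_num))
      · have h1 := ell_aux_pos b hb θ
        have h3 := ell_aux_pos' b hb θ
        rw [ell_aux_K]
        have := Real.sqrt_pos.2 (by linarith : 0 < 2 * (b ^ 2 * Real.sin θ ^ 2 + Real.cos θ ^ 2))
        have := Real.rpow_pos_of_pos
          (by linarith : 0 < b ^ 2 * Real.cos θ ^ 2 + Real.sin θ ^ 2) ((5:ℝ) / 2)
        positivity
    · intro θ hθ
      have hs := Real.sin_nonneg_of_mem_Icc hθ
      have h1 := ell_aux_pos b hb θ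
      have h3 := ell_aux_pos' b hb θ
      have hsc := Real.sin_sq_add_cos_sq θ
      rw [ell_aux_K, ell_aux_rpow _ (by linarith), Real.sqrt_mul (by norm_num)]
      have hr := Real.sqrt_pos.2 (by linarith : 0 < b ^ 2 * Real.cos θ ^ 2 + Real.sin θ ^ 2)
      have hq := Real.sqrt_pos.2 (by linarith : 0 < b ^ 2 * Real.sin θ ^ 2 + Real.cos θ ^ 2)
      have hq2 := Real.sq_sqrt (by linarith : 0 ≤ b ^ 2 * Real.sin θ ^ 2 + Real.cos θ ^ 2)
      have hnum : 2 * b ^ 2 - (b ^ 2 - 1) ^ 2 * Real.sin θ ^ 2 * Real.cos θ ^ 2 =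
          3 * b ^ 2 - (b ^ 2 * Real.cos θ ^ 2 + Real.sin θ ^ 2) *
            (b ^ 2 * Real.sin θ ^ 2 + Real.cos θ ^ 2) := by
        rw [Real.sin_sq]; ring
      rw [hnum]
      have hqb : Real.sqrt (b ^ 2 * Real.sin θ ^ 2 + Real.cos θ ^ 2) ≤ b := by
        apply Real.sqrt_le_iff.2 ⟨hb0.le, _⟩
        nlinarith [mul_nonneg (by nlinarith : 0 ≤ b ^ 2 - 1) (sq_nonneg (Real.cos θ))]
      generalize Real.sqrt (b ^ 2 * Real.sin θ ^ 2 + Real.cos θ ^ 2) = q at *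
      rw [← hq2]
      generalize Real.sqrt (b ^ 2 * Real.cos θ ^ 2 + Real.sin θ ^ 2) = r at *
      generalize b ^ 2 * Real.cos θ ^ 2 + Real.sin θ ^ 2 = P at *
      rw [div_div, div_le_div_iff₀ (by positivity) (by positivity)]
      have key : b * (3 - P) * q ≤ 3 * b ^ 2 - P * q ^ 2 := by
        nlinarith [mul_nonneg (by linarith : 0 ≤ b - q)
          (by positivity : 0 ≤ 3 * b + P * q)]
      have := mul_le_mul_of_nonneg_right key
        (by positivity : 0 ≤ Real.sin θ * r ^ 5 * Real.sqrt 2)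
      linarith
  rw [intervalIntegral.integral_div, hinteg] at hmono
  refine le_trans ?_ hmono
  rw [le_div_iff₀ h2, ← sq, h22]
  have e1 : b * b⁻¹ = 1 := mul_inv_cancel₀ hb0.ne'
  have e2 : 0 ≤ b * (b ^ 3)⁻¹ := by positivity
  linarith
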